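/- arXiv:2003.11333 — 2 statements merged into one kernel-verified Lean document; each statement's English description precedes it below -/
import Mathlib

section
/- Let n ≥ 1, θ ≥ 0, and positive reals γ_1, …, γ_n with γ_max = max_{j=1..n} γ_j. Let B_i and B_k be hyperboxes with bounds v_{ij} ≤ w_{ij} and v_{kj} ≤ w_{kj} satisfying w_{ij} − v_{ij} ≤ θ and w_{kj} − v_{kj} ≤ θ for all j. If the shortest-distance-based similarity value s̃(B_i, B_k) = min_{j=1..n} min(1 − f(v_{kj} − w_{ij}, γ_j), 1 − f(v_{ij} − w_{kj}, γ_j)) satisfies s̃(B_i, B_k) < 1 − θ·γ_max, then there exists a dimension j with max(w_{ij}, w_{kj}) − min(v_{ij}, v_{kj}) > θ; i.e., the hyperbox aggregated from B_i and B_k violates the maximum hyperbox size condition in some dimension. -/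
/-- The ramp function `f(z, γ) = max(0, min(1, z·γ))`. -/
noncomputable def ramp (z γ : ℝ) : ℝ := max 0 (min 1 (z * γ))

theorem lt_of_mul_lt_ramp {z γ θ : ℝ} (hγ : 0 < γ) (hθ : 0 ≤ θ) (h : θ * γ < ramp z γ) :
    θ < z := by
  rcases lt_max_iff.1 h with h | h
  · exact absurd h (mul_nonneg hθ hγ.le).not_gt
  · exact lt_of_mul_lt_mul_right (lt_min_iff.1 h).2 hγ.le

theorem stmt_8 (n : ℕ) (hn : 1 ≤ n) (θ : ℝ) (hθ : 0 ≤ θ)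
    (γ : Fin n → ℝ) (hγ : ∀ j, 0 < γ j)
    (vi wi vk wk : Fin n → ℝ)
    (hvwi : ∀ j, vi j ≤ wi j) (hvwk : ∀ j, vk j ≤ wk j)
    (hsizei : ∀ j, wi j - vi j ≤ θ) (hsizek : ∀ j, wk j - vk j ≤ θ)
    (hs : Finset.univ.inf' (Finset.univ_nonempty_iff.2 ⟨⟨0, hn⟩⟩)
        (fun j => min (1 - ramp (vk j - wi j) (γ j)) (1 - ramp (vi j - wk j) (γ j)))
      < 1 - θ * Finset.univ.sup' (Finset.univ_nonempty_iff.2 ⟨⟨0, hn⟩⟩) γ) :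
    ∃ j, max (wi j) (wk j) - min (vi j) (vk j) > θ := by
  obtain ⟨j, -, hj⟩ := (Finset.inf'_lt_iff _).1 hs
  have hmax : θ * γ j ≤ θ * Finset.univ.sup' (Finset.univ_nonempty_iff.2 ⟨⟨0, hn⟩⟩) γ :=
    mul_le_mul_of_nonneg_left (Finset.le_sup' γ (Finset.mem_univ j)) hθ
  refine ⟨j, ?_⟩
  rcases min_lt_iff.1 hj with h | h
  · have hgap : θ < vk j - wi j := lt_of_mul_lt_ramp (hγ j) hθ (by linarith)
    linarith [le_max_right (wi j) (wk j), min_le_left (vi j) (vk j), hvwi j, hvwk j]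
  · have hgap : θ < vi j - wk j := lt_of_mul_lt_ramp (hγ j) hθ (by linarith)
    linarith [le_max_left (wi j) (wk j), min_le_right (vi j) (vk j), hvwi j, hvwk j]
end

section
/- Let n ≥ 1, θ ≥ 0, and positive reals γ_1, …, γ_n with γ_max = max_{j=1..n} γ_j. Let B_i and B_k be hyperboxes with bounds v_{ij} ≤ w_{ij} and v_{kj} ≤ w_{kj} satisfying w_{ij} − v_{ij} ≤ θ and w_{kj} − v_{kj} ≤ θ for all j. If the middle-distance-based similarity value s(B_i, B_k) = min_{j=1..n} min(1 − f(w_{kj} − w_{ij}, γ_j), 1 − f(v_{ij} − v_{kj}, γ_j)) satisfies s(B_i, B_k) < 1 − θ·γ_max, then there exists a dimension j with max(w_{ij}, w_{kj}) − min(v_{ij}, v_{kj}) > θ; i.e., the hyperbox aggregated from B_i and B_k violates the maximum hyperbox size condition in some dimension. -/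
theorem ramp_le_mul {z γ θ M : ℝ} (hθ : 0 ≤ θ) (hγ : 0 ≤ γ) (hz : z ≤ θ) (hM : γ ≤ M) :
    ramp z γ ≤ θ * M :=
  max_le (mul_nonneg hθ (hγ.trans hM))
    ((min_le_right _ _).trans (mul_le_mul hz hM hγ hθ))

theorem stmt_10 (n : ℕ) (hn : 1 ≤ n) (θ : ℝ) (hθ : 0 ≤ θ)
    (γ : Fin n → ℝ) (hγ : ∀ j, 0 < γ j)
    (vi wi vk wk : Fin n → ℝ)
    (hvwi : ∀ j, vi j ≤ wi j) (hvwk : ∀ j, vk j ≤ wk j)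
    (hsizei : ∀ j, wi j - vi j ≤ θ) (hsizek : ∀ j, wk j - vk j ≤ θ)
    (hs : Finset.univ.inf' (Finset.univ_nonempty_iff.2 ⟨⟨0, hn⟩⟩)
        (fun j => min (1 - ramp (wk j - wi j) (γ j)) (1 - ramp (vi j - vk j) (γ j)))
      < 1 - θ * Finset.univ.sup' (Finset.univ_nonempty_iff.2 ⟨⟨0, hn⟩⟩) γ) :
    ∃ j, max (wi j) (wk j) - min (vi j) (vk j) > θ := by
  by_contra! h
  refine hs.not_ge (Finset.le_inf' _ _ fun j _ => le_min ?_ ?_)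
  all_goals
    refine sub_le_sub_left (ramp_le_mul hθ (hγ j).le ?_
      (Finset.le_sup' γ (Finset.mem_univ j))) 1
    linarith [h j, hvwi j, le_max_left (wi j) (wk j), le_max_right (wi j) (wk j),
      min_le_left (vi j) (vk j), min_le_right (vi j) (vk j)]
end
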